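/- arXiv:2212.09378 — 2 statements merged into one kernel-verified Lean document; each statement's English description precedes it below -/
import Mathlib

section
/- Let F = {f_1, …, f_m} be a CPLIFS with attractor Λ and natural projection Π. Let b ∈ Λ be a breaking point of some f_k, and assume that b has only finitely many codings and that every coding of b is periodic. Let P ≥ 1 be a common multiple of the periods of all codings of b. Then for every word w ∈ {1,…,m}^P with b ∈ f_w(Λ), the point b is the unique fixed point of the contraction f_w, i.e. f_w(b) = b. -/
open Set Filter MeasureTheory Topology

noncomputable section

/-- For a word `w = [i₁, …, iₙ]`, `fw f w = f i₁ ∘ ⋯ ∘ f iₙ`. -/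
def fw {m : ℕ} (f : Fin m → ℝ → ℝ) : List (Fin m) → ℝ → ℝ :=
  fun w => w.foldr (fun k g => f k ∘ g) id

/-- `InPiece bk i x` means that `x` belongs to the (closure of the) `i`-th interval of
linearity determined by the strictly increasing breaking points `bk`. -/
def InPiece {L : ℕ} (bk : Fin L → ℝ) (i : Fin (L + 1)) (x : ℝ) : Prop :=
  (∀ j : Fin L, (j : ℕ) < (i : ℕ) → bk j ≤ x) ∧
  (∀ j : Fin L, (i : ℕ) ≤ (j : ℕ) → x ≤ bk j)

/-- A continuous piecewise linear iterated function system on `ℝ` with `m` maps: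
each `f k` has `l k` breaking points `b k 0 < ⋯ < b k (l k - 1)`, is affine with slope
`ρ k i ∈ (-1,1) \ {0}` on the `i`-th interval of linearity, and has distinct slopes on
consecutive intervals. -/
structure CPLIFS (m : ℕ) where
  f : Fin m → ℝ → ℝ
  l : Fin m → ℕ
  b : (k : Fin m) → Fin (l k) → ℝ
  ρ : (k : Fin m) → Fin (l k + 1) → ℝ
  hm : 2 ≤ m
  hb : ∀ k, StrictMono (b k)
  hρ0 : ∀ k i, ρ k i ≠ 0
  hρ1 : ∀ k i, |ρ k i| < 1
  hρne : ∀ k (i : Fin (l k)), ρ k i.castSucc ≠ ρ k i.succ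
  hpiece : ∀ k (i : Fin (l k + 1)) (x y : ℝ),
    InPiece (b k) i x → InPiece (b k) i y → f k x - f k y = ρ k i * (x - y)

/-- `Λ` is the attractor of `F`: the (unique) nonempty compact set with `Λ = ⋃ₖ f k (Λ)`. -/
def IsAttractor {m : ℕ} (F : CPLIFS m) (Λ : Set ℝ) : Prop :=
  Λ.Nonempty ∧ IsCompact Λ ∧ Λ = ⋃ k, F.f k '' Λ

/-- `c ∈ {1,…,m}^ℕ` is a coding of `x`: the natural projection sends `c` to `x`. -/
def IsCoding {m : ℕ} (F : CPLIFS m) (c : ℕ → Fin m) (x : ℝ) : Prop :=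
  ∀ x₀ : ℝ, Tendsto (fun n => fw F.f (List.ofFn fun j : Fin n => c j) x₀) atTop (nhds x)

/-- `x` is a breaking point of (one of the maps of) `F`. -/
def IsBreakPoint {m : ℕ} (F : CPLIFS m) (x : ℝ) : Prop := ∃ k j, F.b k j = x

/-- Two points with no breaking point strictly
between them lie in a common piece. -/
theorem exists_inPiece {L : ℕ} {bk : Fin L → ℝ} (hbk : StrictMono bk) {x y : ℝ} (hxy : x ≤ y)
    (hgap : ∀ j, ¬ (x < bk j ∧ bk j < y)) :
    ∃ i : Fin (L + 1), InPiece bk i x ∧ InPiece bk i y := by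
  classical
  have hex : ∃ n : ℕ, n ≤ L ∧ ∀ j : Fin L, n ≤ (j : ℕ) → x < bk j :=
    ⟨L, le_rfl, fun j hj => absurd j.2 (by omega)⟩
  obtain ⟨hle, hright⟩ := Nat.find_spec hex
  have hleft : ∀ j : Fin L, (j : ℕ) < Nat.find hex → bk j ≤ x := by
    intro j hj
    by_contra! hlt
    exact Nat.find_min hex hj
      ⟨j.2.le, fun j' hj' => hlt.trans_le (hbk.monotone (Fin.le_def.2 hj'))⟩
  refine ⟨⟨Nat.find hex, by omega⟩, ⟨hleft, fun j hj => (hright j hj).le⟩,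
    fun j hj => (hleft j hj).trans hxy, fun j hj => ?_⟩
  by_contra! hlt
  exact hgap j ⟨hright j hj, hlt⟩

namespace CPLIFS

variable {m : ℕ} (F : CPLIFS m)

theorem exists_slope_bound : ∃ r : ℝ, 0 ≤ r ∧ r < 1 ∧ ∀ k i, |F.ρ k i| ≤ r := by
  have : Nonempty (Σ k : Fin m, Fin (F.l k + 1)) := ⟨⟨⟨0, by have := F.hm; omega⟩, 0⟩⟩
  obtain ⟨q, hq⟩ := Finite.exists_max fun p : Σ k : Fin m, Fin (F.l k + 1) => |F.ρ p.1 p.2|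
  exact ⟨|F.ρ q.1 q.2|, abs_nonneg _, F.hρ1 _ _, fun k i => hq ⟨k, i⟩⟩

theorem abs_sub_le_of_le {r : ℝ} (hr : ∀ k i, |F.ρ k i| ≤ r) (k : Fin m) {x y : ℝ}
    (hxy : x ≤ y) : |F.f k x - F.f k y| ≤ r * (y - x) := by
  classical
  -- Induction on the number of breaking points strictly between `x` and `y`.
  induction hn : (Finset.univ.filter fun j => x < F.b k j ∧ F.b k j < y).card
    using Nat.strong_induction_on generalizing x y with
  | _ n ih =>
    by_cases hgap : ∃ j, x < F.b k j ∧ F.b k j < y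
    · obtain ⟨j, hxj, hjy⟩ := hgap
      have hleft := ih _ (hn ▸ Finset.card_lt_card (Finset.ssubset_iff_of_subset (fun i hi => by
        simp only [Finset.mem_filter, Finset.mem_univ, true_and] at hi ⊢
        exact ⟨hi.1, hi.2.trans hjy⟩) |>.2 ⟨j, by simp [hxj, hjy], by simp⟩)) hxj.le rfl
      have hright := ih _ (hn ▸ Finset.card_lt_card (Finset.ssubset_iff_of_subset (fun i hi => by
        simp only [Finset.mem_filter, Finset.mem_univ, true_and] at hi ⊢
        exact ⟨hxj.trans hi.1, hi.2⟩) |>.2 ⟨j, by simp [hxj, hjy], by simp⟩)) hjy.le rfl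
      calc |F.f k x - F.f k y|
          ≤ |F.f k x - F.f k (F.b k j)| + |F.f k (F.b k j) - F.f k y| := abs_sub_le _ _ _
        _ ≤ r * (y - x) := by linarith
    · obtain ⟨i, hx, hy⟩ := exists_inPiece (F.hb k) hxy (not_exists.1 hgap)
      rw [F.hpiece k i x y hx hy, abs_mul, abs_sub_comm, abs_of_nonneg (sub_nonneg.2 hxy)]
      exact mul_le_mul_of_nonneg_right (hr k i) (sub_nonneg.2 hxy)

theorem abs_sub_le {r : ℝ} (hr : ∀ k i, |F.ρ k i| ≤ r) (k : Fin m) (x y : ℝ) :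
    |F.f k x - F.f k y| ≤ r * |x - y| := by
  rcases le_total x y with h | h
  · rw [abs_sub_comm x y, abs_of_nonneg (sub_nonneg.2 h)]
    exact F.abs_sub_le_of_le hr k h
  · rw [abs_sub_comm, abs_of_nonneg (sub_nonneg.2 h)]
    exact F.abs_sub_le_of_le hr k h

theorem continuous_f (k : Fin m) : Continuous (F.f k) := by
  obtain ⟨r, hr0, -, hr⟩ := F.exists_slope_bound
  exact (LipschitzWith.of_dist_le_mul (K := ⟨r, hr0⟩) fun x y => F.abs_sub_le hr k x y).continuous

theorem abs_fw_sub_le {r : ℝ} (hr0 : 0 ≤ r) (hr : ∀ k i, |F.ρ k i| ≤ r) (w : List (Fin m))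
    (x y : ℝ) : |fw F.f w x - fw F.f w y| ≤ r ^ w.length * |x - y| := by
  induction w with
  | nil => simp [fw]
  | cons k w ih =>
    calc |F.f k (fw F.f w x) - F.f k (fw F.f w y)|
        ≤ r * |fw F.f w x - fw F.f w y| := F.abs_sub_le hr k _ _
      _ ≤ r * (r ^ w.length * |x - y|) := mul_le_mul_of_nonneg_left ih hr0
      _ = r ^ (k :: w).length * |x - y| := by rw [List.length_cons, pow_succ]; ring

theorem fw_orbit {c : ℕ → Fin m} {y : ℕ → ℝ} (h : ∀ n, F.f (c n) (y (n + 1)) = y n) (n : ℕ) :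
    fw F.f (List.ofFn fun j : Fin n => c j) (y n) = y 0 := by
  induction n generalizing c y with
  | zero => simp [fw]
  | succ n ih =>
    rw [List.ofFn_succ]
    change F.f (c 0) (fw F.f (List.ofFn fun j : Fin n => c (j + 1)) (y (n + 1))) = y 0
    rw [ih (c := fun n => c (n + 1)) (y := fun n => y (n + 1)) fun n => h (n + 1)]
    exact h 0

theorem isCoding_of_orbit {Λ : Set ℝ} (hΛ : IsCompact Λ) {c : ℕ → Fin m} {y : ℕ → ℝ}
    (hy : ∀ n, y n ∈ Λ) (h : ∀ n, F.f (c n) (y (n + 1)) = y n) : IsCoding F c (y 0) := by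
  intro x₀
  obtain ⟨r, hr0, hr1, hr⟩ := F.exists_slope_bound
  obtain ⟨C, hC⟩ := hΛ.isBounded.subset_closedBall x₀
  rw [tendsto_iff_dist_tendsto_zero]
  refine squeeze_zero (fun _ => dist_nonneg) (g := fun n => r ^ n * C) (fun n => ?_) ?_
  · have hyn : |x₀ - y n| ≤ C := by
      rw [abs_sub_comm]
      exact hC (hy n)
    calc dist (fw F.f (List.ofFn fun j : Fin n => c j) x₀) (y 0)
        = |fw F.f (List.ofFn fun j : Fin n => c j) x₀ -
            fw F.f (List.ofFn fun j : Fin n => c j) (y n)| := by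
          rw [F.fw_orbit h n, Real.dist_eq]
      _ ≤ r ^ n * |x₀ - y n| := by
          simpa using F.abs_fw_sub_le hr0 hr (List.ofFn fun j : Fin n => c j) x₀ (y n)
      _ ≤ r ^ n * C := mul_le_mul_of_nonneg_left hyn (pow_nonneg hr0 n)
  · simpa using (tendsto_pow_atTop_nhds_zero_of_lt_one hr0 hr1).mul_const C

theorem exists_isCoding {Λ : Set ℝ} (hΛ : IsAttractor F Λ) {x : ℝ} (hx : x ∈ Λ) :
    ∃ c, IsCoding F c x := by
  have hpre : ∀ z : Λ, ∃ k, ∃ y : Λ, F.f k y = z := by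
    rintro ⟨z, hz⟩
    rw [hΛ.2.2] at hz
    obtain ⟨k, y, hy, hyz⟩ := mem_iUnion.1 hz
    exact ⟨k, ⟨y, hy⟩, hyz⟩
  choose k g hg using hpre
  refine ⟨fun n => k (g^[n] ⟨x, hx⟩), F.isCoding_of_orbit hΛ.2.1
    (y := fun n => (g^[n] ⟨x, hx⟩ : Λ)) (fun n => Subtype.coe_prop _) fun n => ?_⟩
  rw [Function.iterate_succ_apply']
  exact hg _

variable {F}

theorem _root_.IsCoding.cons {c : ℕ → Fin m} {x : ℝ} (hc : IsCoding F c x) (k : Fin m) :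
    IsCoding F (fun n => Nat.casesOn n k c) (F.f k x) := by
  intro x₀
  rw [← tendsto_add_atTop_iff_nat 1]
  refine (((F.continuous_f k).tendsto x).comp (hc x₀)).congr fun n => ?_
  rw [List.ofFn_succ]
  rfl

theorem _root_.IsCoding.exists_append {d : ℕ → Fin m} {y : ℝ} (hd : IsCoding F d y)
    (w : List (Fin m)) :
    ∃ c, IsCoding F c (fw F.f w y) ∧ ∀ n, c (n + w.length) = d n := by
  induction w with
  | nil => exact ⟨d, hd, fun n => rfl⟩
  | cons k w ih =>
    obtain ⟨c, hc, hcd⟩ := ih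
    exact ⟨_, hc.cons k, fun n => hcd n⟩

end CPLIFS

/-- If a breaking point `b ∈ Λ` has only finitely many codings, all
periodic, and `P ≥ 1` is a common multiple of the periods of all codings of `b` (i.e. `P`
is a period of every coding of `b`), then for every word `w` of length `P` with
`b ∈ f_w(Λ)`, the point `b` is the (unique) fixed point of the contraction `f_w`. -/
theorem statement1 {m : ℕ} (F : CPLIFS m) (Λ : Set ℝ) (hΛ : IsAttractor F Λ)
    (b : ℝ) (hbrk : IsBreakPoint F b) (hbΛ : b ∈ Λ)
    (hfin : {c : ℕ → Fin m | IsCoding F c b}.Finite)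
    (hper : ∀ c : ℕ → Fin m, IsCoding F c b → ∃ p : ℕ, 1 ≤ p ∧ Function.Periodic c p)
    (P : ℕ) (hP : 1 ≤ P)
    (hcm : ∀ c : ℕ → Fin m, IsCoding F c b → Function.Periodic c P) :
    ∀ w : List (Fin m), w.length = P → b ∈ fw F.f w '' Λ → fw F.f w b = b := by
  rintro w rfl ⟨y, hy, hyb⟩
  obtain ⟨d, hd⟩ := F.exists_isCoding hΛ hy
  obtain ⟨c, hc, hcd⟩ := hd.exists_append w
  rw [hyb] at hc
  have hdc : d = c := funext fun n => by rw [← hcd n, hcm c hc n]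
  subst hdc
  obtain rfl : y = b := tendsto_nhds_unique (hd 0) (hc 0)
  exact hyb
end
end

section
/- Under the three-map fixed-point-breaking hypotheses, for s ≥ 0 let M(s) be the 4×4 matrix with rows (ρ_1^s, ρ_1^s, ρ_1^s, ρ_1^s), (ρ_2^s, ρ_2^s, 0, 0), (0, 0, ρ_3^s, ρ_3^s), (ρ_4^s, ρ_4^s, ρ_4^s, ρ_4^s). There is a unique s* ≥ 0 for which the spectral radius of M(s*) equals 1; this s* satisfies the equation ρ_1^{s*} + ρ_2^{s*} + ρ_3^{s*} + ρ_4^{s*} − ρ_1^{s*}ρ_3^{s*} − ρ_2^{s*}ρ_3^{s*} − ρ_2^{s*}ρ_4^{s*} = 1, and the Hausdorff dimension of the attractor Λ equals s*. -/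
open Set

noncomputable section

/-- `f₁(x) = ρ₁ x`. -/
def mapOne (ρ1 : ℝ) (x : ℝ) : ℝ := ρ1 * x

/-- `f₂` breaks at its fixed point `φ₂`, with slope `ρ₂` on the left and `ρ₃` on the right. -/
def mapTwo (φ2 ρ2 ρ3 : ℝ) (x : ℝ) : ℝ :=
  if x ≤ φ2 then ρ2 * x + φ2 * (1 - ρ2) else ρ3 * x + φ2 * (1 - ρ3)

/-- `f₃(x) = ρ₄ x + (1 - ρ₄)`. -/
def mapThree (ρ4 : ℝ) (x : ℝ) : ℝ := ρ4 * x + (1 - ρ4)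

/-- The 4×4 matrix `M(s)` of the graph-directed system associated with the three-map
fixed-point-breaking CPLIFS. -/
def gdMatrix (ρ1 ρ2 ρ3 ρ4 s : ℝ) : Matrix (Fin 4) (Fin 4) ℝ :=
  !![ρ1 ^ s, ρ1 ^ s, ρ1 ^ s, ρ1 ^ s;
     ρ2 ^ s, ρ2 ^ s, 0, 0;
     0, 0, ρ3 ^ s, ρ3 ^ s;
     ρ4 ^ s, ρ4 ^ s, ρ4 ^ s, ρ4 ^ s]

/-- The larger eigenvalue of the graph-directed matrix, in terms of its nonzero entries. -/
def perronRoot (a b c d : ℝ) : ℝ :=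
  (a + b + c + d + √((a + b - c - d) ^ 2 + 4 * (a * d))) / 2

theorem perronRoot_eq_one_iff (a b c d : ℝ) (had : 0 ≤ a * d) :
    perronRoot a b c d = 1 ↔
      a + b + c + d ≤ 2 ∧ a + b + c + d - a * c - b * c - b * d = 1 := by
  have hdisc : 0 ≤ (a + b - c - d) ^ 2 + 4 * (a * d) := by positivity
  have hroot : perronRoot a b c d = 1 ↔
      √((a + b - c - d) ^ 2 + 4 * (a * d)) = 2 - (a + b + c + d) := by
    unfold perronRoot
    constructor <;> intro h <;> linarith
  rw [hroot]
  constructor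
  · intro h
    have hnn := Real.sqrt_nonneg ((a + b - c - d) ^ 2 + 4 * (a * d))
    have hsq := Real.sq_sqrt hdisc
    rw [h] at hsq
    exact ⟨by linarith, by nlinarith⟩
  · rintro ⟨hle, heq⟩
    rw [Real.sqrt_eq_iff_mul_self_eq hdisc (by linarith)]
    nlinarith

theorem mem_spectrum_gdMatrix_iff (ρ1 ρ2 ρ3 ρ4 s : ℝ) (z : ℂ) :
    z ∈ spectrum ℂ ((gdMatrix ρ1 ρ2 ρ3 ρ4 s).map (fun x : ℝ => (x : ℂ))) ↔
      z = 0 ∨ (z - (ρ2 ^ s : ℝ)) * (z - (ρ3 ^ s : ℝ)) - (ρ1 ^ s : ℝ) * (z - (ρ3 ^ s : ℝ))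
        - (ρ4 ^ s : ℝ) * (z - (ρ2 ^ s : ℝ)) = 0 := by
  rw [spectrum.mem_iff, Matrix.isUnit_iff_isUnit_det, isUnit_iff_ne_zero, not_not]
  unfold gdMatrix
  generalize ρ1 ^ s = a
  generalize ρ2 ^ s = b
  generalize ρ3 ^ s = c
  generalize ρ4 ^ s = d
  have hdet : (algebraMap ℂ (Matrix (Fin 4) (Fin 4) ℂ) z -
      (!![a, a, a, a; b, b, 0, 0; 0, 0, c, c; d, d, d, d]).map (fun x : ℝ => (x : ℂ))).det =
      z ^ 2 * ((z - b) * (z - c) - a * (z - c) - d * (z - b)) := by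
    have hmat : algebraMap ℂ (Matrix (Fin 4) (Fin 4) ℂ) z -
        (!![a, a, a, a; b, b, 0, 0; 0, 0, c, c; d, d, d, d]).map (fun x : ℝ => (x : ℂ)) =
        !![z - a, -a, -a, -a; -b, z - b, 0, 0; 0, 0, z - c, -c; -d, -d, -d, z - d] := by
      ext i j
      fin_cases i <;> fin_cases j <;> simp [Matrix.algebraMap_matrix_apply]
    rw [hmat]
    simp [Matrix.det_succ_row_zero, Fin.sum_univ_succ, Fin.succAbove]
    ring
  rw [hdet]
  simp

theorem spectralRadius_gdMatrix {ρ1 ρ2 ρ3 ρ4 : ℝ} (s : ℝ)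
    (h1 : 0 < ρ1) (h2 : 0 < ρ2) (h3 : 0 < ρ3) (h4 : 0 < ρ4) :
    spectralRadius ℂ ((gdMatrix ρ1 ρ2 ρ3 ρ4 s).map (fun x : ℝ => (x : ℂ))) =
      ENNReal.ofReal (perronRoot (ρ1 ^ s) (ρ2 ^ s) (ρ3 ^ s) (ρ4 ^ s)) := by
  have hmem := mem_spectrum_gdMatrix_iff ρ1 ρ2 ρ3 ρ4 s
  have ha : 0 < ρ1 ^ s := Real.rpow_pos_of_pos h1 s
  have hb : 0 < ρ2 ^ s := Real.rpow_pos_of_pos h2 s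
  have hc : 0 < ρ3 ^ s := Real.rpow_pos_of_pos h3 s
  have hd : 0 < ρ4 ^ s := Real.rpow_pos_of_pos h4 s
  set a := ρ1 ^ s
  set b := ρ2 ^ s
  set c := ρ3 ^ s
  set d := ρ4 ^ s
  set w := √((a + b - c - d) ^ 2 + 4 * (a * d)) with hw
  have hw0 : 0 ≤ w := Real.sqrt_nonneg _
  have hwsq : w ^ 2 = (a + b - c - d) ^ 2 + 4 * (a * d) := Real.sq_sqrt (by positivity)
  have hr : perronRoot a b c d = (a + b + c + d + w) / 2 := rfl
  have hfactor : ∀ z : ℂ, (z - b) * (z - c) - a * (z - c) - d * (z - b) =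
      (z - ((a + b + c + d + w) / 2 : ℝ)) * (z - ((a + b + c + d - w) / 2 : ℝ)) := by
    intro z
    have hwsq' : (w : ℂ) ^ 2 = (a + b - c - d) ^ 2 + 4 * (a * d) := by exact_mod_cast hwsq
    push_cast
    linear_combination (1 / 4 : ℂ) * hwsq'
  rw [hr]
  refine le_antisymm (iSup₂_le fun z hz => ?_) ?_
  · rw [← ENNReal.ofReal_coe_nnreal, coe_nnnorm]
    apply ENNReal.ofReal_le_ofReal
    rw [hmem, hfactor, mul_eq_zero, sub_eq_zero, sub_eq_zero] at hz
    rcases hz with rfl | rfl | rfl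
    · rw [norm_zero]; positivity
    · rw [Complex.norm_real, Real.norm_of_nonneg (by positivity)]
    · rw [Complex.norm_real, Real.norm_eq_abs, abs_le]
      constructor <;> linarith
  · have hz : (((a + b + c + d + w) / 2 : ℝ) : ℂ) ∈
        spectrum ℂ ((gdMatrix ρ1 ρ2 ρ3 ρ4 s).map (fun x : ℝ => (x : ℂ))) := by
      rw [hmem, hfactor, sub_self, zero_mul]
      exact Or.inr rfl
    refine le_trans (le_of_eq ?_) (le_iSup₂ _ hz)
    rw [← ENNReal.ofReal_coe_nnreal, coe_nnnorm, Complex.norm_real,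
      Real.norm_of_nonneg (by positivity)]

theorem spectralRadius_gdMatrix_eq_one_iff {ρ1 ρ2 ρ3 ρ4 : ℝ} (s : ℝ)
    (h1 : 0 < ρ1) (h2 : 0 < ρ2) (h3 : 0 < ρ3) (h4 : 0 < ρ4) :
    spectralRadius ℂ ((gdMatrix ρ1 ρ2 ρ3 ρ4 s).map (fun x : ℝ => (x : ℂ))) = 1 ↔
      perronRoot (ρ1 ^ s) (ρ2 ^ s) (ρ3 ^ s) (ρ4 ^ s) = 1 := by
  rw [spectralRadius_gdMatrix s h1 h2 h3 h4, ENNReal.ofReal_eq_one]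

theorem exists_perronRoot_rpow_eq_one {ρ1 ρ2 ρ3 ρ4 : ℝ}
    (h1 : ρ1 ∈ Ioo (0:ℝ) 1) (h2 : ρ2 ∈ Ioo (0:ℝ) 1)
    (h3 : ρ3 ∈ Ioo (0:ℝ) 1) (h4 : ρ4 ∈ Ioo (0:ℝ) 1) :
    ∃ s : ℝ, 0 < s ∧ perronRoot (ρ1 ^ s) (ρ2 ^ s) (ρ3 ^ s) (ρ4 ^ s) = 1 := by
  set R : ℝ → ℝ := fun s => perronRoot (ρ1 ^ s) (ρ2 ^ s) (ρ3 ^ s) (ρ4 ^ s) with hR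
  have hcont : Continuous R := by
    have c1 := Real.continuous_const_rpow h1.1.ne'
    have c2 := Real.continuous_const_rpow h2.1.ne'
    have c3 := Real.continuous_const_rpow h3.1.ne'
    have c4 := Real.continuous_const_rpow h4.1.ne'
    simp only [hR, perronRoot]
    fun_prop
  have hzero : R 0 = 3 := by
    have hsqrt : √(4 : ℝ) = 2 := by
      rw [show (4 : ℝ) = 2 ^ 2 by norm_num]; exact Real.sqrt_sq (by norm_num)
    simp only [hR, perronRoot, Real.rpow_zero]
    norm_num [hsqrt]
  have hlim : Filter.Tendsto R Filter.atTop (nhds 0) := by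
    have t : ∀ {ρ : ℝ}, ρ ∈ Ioo (0:ℝ) 1 →
        Filter.Tendsto (fun s : ℝ => ρ ^ s) Filter.atTop (nhds 0) := fun h =>
      tendsto_rpow_atTop_of_base_lt_one _ (by linarith [h.1]) h.2
    have hp : Continuous fun v : ℝ × ℝ × ℝ × ℝ => perronRoot v.1 v.2.1 v.2.2.1 v.2.2.2 := by
      unfold perronRoot
      fun_prop
    have := (hp.tendsto (0, 0, 0, 0)).comp
      ((t h1).prodMk_nhds ((t h2).prodMk_nhds ((t h3).prodMk_nhds (t h4))))
    rwa [show perronRoot 0 0 0 0 = 0 by simp [perronRoot]] at this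
  obtain ⟨N, hN, hN0⟩ := ((hlim.eventually (gt_mem_nhds one_pos)).and
    (Filter.eventually_ge_atTop (0 : ℝ))).exists
  obtain ⟨s, hs, hs1⟩ := intermediate_value_Icc' hN0 hcont.continuousOn
    (show (1 : ℝ) ∈ Icc (R N) (R 0) from ⟨hN.le, by rw [hzero]; norm_num⟩)
  refine ⟨s, lt_of_le_of_ne hs.1 ?_, hs1⟩
  rintro rfl
  rw [hzero] at hs1
  norm_num at hs1

/-- For a positive exponent, the larger eigenvalue is `1` exactly when the geometric series of
the return words sum to `1`. -/
theorem perronRoot_eq_one_iff_div {a b c d : ℝ} (ha : 0 < a) (hb : b ∈ Ioo (0:ℝ) 1)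
    (hc : c ∈ Ioo (0:ℝ) 1) (hd : 0 < d) :
    perronRoot a b c d = 1 ↔ a / (1 - b) + d / (1 - c) = 1 := by
  have hb' : 0 < 1 - b := sub_pos.2 hb.2
  have hc' : 0 < 1 - c := sub_pos.2 hc.2
  rw [perronRoot_eq_one_iff a b c d (by positivity), div_add_div _ _ hb'.ne' hc'.ne',
    div_eq_one_iff_eq (by positivity)]
  constructor
  · rintro ⟨-, h⟩
    linarith
  · intro h
    refine ⟨?_, by linarith⟩
    have hab : a ≤ 1 - b := by
      by_contra! hlt
      nlinarith [mul_pos hb' hd, mul_pos (sub_pos.2 hlt) hc']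
    have hdc : d ≤ 1 - c := by
      by_contra! hlt
      nlinarith [mul_pos hc' ha, mul_pos (sub_pos.2 hlt) hb']
    linarith

theorem rpow_mem_Ioo {ρ s : ℝ} (h : ρ ∈ Ioo (0:ℝ) 1) (hs : 0 < s) : ρ ^ s ∈ Ioo (0:ℝ) 1 :=
  ⟨Real.rpow_pos_of_pos h.1 s, Real.rpow_lt_one h.1.le h.2 hs⟩

theorem strictAntiOn_rpow_div_one_sub {ρ σ : ℝ} (hρ : ρ ∈ Ioo (0:ℝ) 1) (hσ : σ ∈ Ioo (0:ℝ) 1) :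
    StrictAntiOn (fun s : ℝ => ρ ^ s / (1 - σ ^ s)) (Ioi 0) := by
  intro s hs t _ hst
  have hρst := Real.rpow_lt_rpow_of_exponent_gt hρ.1 hρ.2 hst
  have hσst := Real.rpow_lt_rpow_of_exponent_gt hσ.1 hσ.2 hst
  have hσs := rpow_mem_Ioo hσ hs
  exact div_lt_div₀ hρst (by linarith) (Real.rpow_pos_of_pos hρ.1 s).le (by linarith [hσs.2])

theorem eq_of_perronRoot_rpow_eq_one {ρ1 ρ2 ρ3 ρ4 s t : ℝ}
    (h1 : ρ1 ∈ Ioo (0:ℝ) 1) (h2 : ρ2 ∈ Ioo (0:ℝ) 1)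
    (h3 : ρ3 ∈ Ioo (0:ℝ) 1) (h4 : ρ4 ∈ Ioo (0:ℝ) 1) (hs : 0 < s) (ht : 0 ≤ t)
    (hs1 : perronRoot (ρ1 ^ s) (ρ2 ^ s) (ρ3 ^ s) (ρ4 ^ s) = 1)
    (ht1 : perronRoot (ρ1 ^ t) (ρ2 ^ t) (ρ3 ^ t) (ρ4 ^ t) = 1) : t = s := by
  rcases ht.eq_or_lt with rfl | ht
  · rw [perronRoot_eq_one_iff _ _ _ _ (by simp)] at ht1
    norm_num at ht1
  have hanti : StrictAntiOn
      (fun s : ℝ => ρ1 ^ s / (1 - ρ2 ^ s) + ρ4 ^ s / (1 - ρ3 ^ s)) (Ioi 0) :=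
    fun x hx y hy hxy => add_lt_add (strictAntiOn_rpow_div_one_sub h1 h2 hx hy hxy)
      (strictAntiOn_rpow_div_one_sub h4 h3 hx hy hxy)
  rw [perronRoot_eq_one_iff_div (rpow_mem_Ioo h1 hs).1 (rpow_mem_Ioo h2 hs)
    (rpow_mem_Ioo h3 hs) (rpow_mem_Ioo h4 hs).1] at hs1
  rw [perronRoot_eq_one_iff_div (rpow_mem_Ioo h1 ht).1 (rpow_mem_Ioo h2 ht)
    (rpow_mem_Ioo h3 ht) (rpow_mem_Ioo h4 ht).1] at ht1
  exact hanti.injOn ht hs (ht1.trans hs1.symm)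

open MeasureTheory in
/-- A `K`-Lipschitz map scales the size-`r` approximation of the Hausdorff measure. -/
theorem LipschitzWith.mkMetric'_pre_image_le {X Y : Type*} [EMetricSpace X] [EMetricSpace Y]
    {K : NNReal} {f : X → Y} (hf : LipschitzWith K f) (hK : 0 < K) {s : ℝ} (hs : 0 ≤ s)
    (r : ENNReal) (E : Set X) :
    OuterMeasure.mkMetric'.pre (fun t : Set Y => Metric.ediam t ^ s) (K * r) (f '' E) ≤
      (K : ENNReal) ^ s *
        OuterMeasure.mkMetric'.pre (fun t : Set X => Metric.ediam t ^ s) r E := by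
  have hK0 : (K : ENNReal) ^ s ≠ 0 := by simp [ENNReal.rpow_eq_zero_iff, hK.ne']
  have hKtop : (K : ENNReal) ^ s ≠ ⊤ := by simp [hK.ne']
  have hle : ((K : ENNReal) ^ s)⁻¹ • OuterMeasure.comap f
      (OuterMeasure.mkMetric'.pre (fun t : Set Y => Metric.ediam t ^ s) (K * r)) ≤
      OuterMeasure.mkMetric'.pre (fun t : Set X => Metric.ediam t ^ s) r := by
    refine OuterMeasure.mkMetric'.le_pre.2 fun t ht => ?_
    have hdiam : Metric.ediam (f '' t) ≤ K * Metric.ediam t := hf.ediam_image_le t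
    simp only [_root_.smul_apply, OuterMeasure.comap_apply, smul_eq_mul]
    rw [ENNReal.inv_mul_le_iff hK0 hKtop, ← ENNReal.mul_rpow_of_nonneg _ _ hs]
    exact (OuterMeasure.mkMetric'.pre_le (hdiam.trans (by gcongr))).trans
      (ENNReal.rpow_le_rpow hdiam hs)
  have := hle E
  simp only [_root_.smul_apply, OuterMeasure.comap_apply, smul_eq_mul] at this
  rwa [ENNReal.inv_mul_le_iff hK0 hKtop] at this

open MeasureTheory in
/-- Upper bound for the Hausdorff dimension of a two-vertex graph-directed attractor admitting a
subinvariant weight `(P, Q)`. -/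
theorem dimH_union_le_of_graphDirected {A B : Set ℝ} {f1 f2 f3 f4 : ℝ → ℝ}
    {K1 K2 K3 K4 s : NNReal} {P Q : ENNReal}
    (hA01 : A ⊆ Icc 0 1) (hB01 : B ⊆ Icc 0 1)
    (hf1 : LipschitzWith K1 f1) (hf2 : LipschitzWith K2 f2)
    (hf3 : LipschitzWith K3 f3) (hf4 : LipschitzWith K4 f4)
    (hK1 : K1 ∈ Ioo 0 1) (hK2 : K2 ∈ Ioo 0 1) (hK3 : K3 ∈ Ioo 0 1) (hK4 : K4 ∈ Ioo 0 1)
    (hA : A ⊆ f1 '' (A ∪ B) ∪ f2 '' A) (hB : B ⊆ f4 '' (A ∪ B) ∪ f3 '' B)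
    (hP1 : 1 ≤ P) (hQ1 : 1 ≤ Q) (hP : P ≠ ⊤) (hQ : Q ≠ ⊤)
    (hPsub : (K1 : ENNReal) ^ (s : ℝ) * (P + Q) + (K2 : ENNReal) ^ (s : ℝ) * P ≤ P)
    (hQsub : (K4 : ENNReal) ^ (s : ℝ) * (P + Q) + (K3 : ENNReal) ^ (s : ℝ) * Q ≤ Q) :
    dimH (A ∪ B) ≤ s := by
  have hs : 0 ≤ (s : ℝ) := s.2
  set N : ENNReal → OuterMeasure ℝ :=
    OuterMeasure.mkMetric'.pre (fun t : Set ℝ => Metric.ediam t ^ (s : ℝ)) with hN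
  obtain ⟨K, hK, hle1, hle2, hle3, hle4⟩ :
      ∃ K : NNReal, K < 1 ∧ K1 ≤ K ∧ K2 ≤ K ∧ K3 ≤ K ∧ K4 ≤ K :=
    ⟨max (max K1 K2) (max K3 K4), by simp [hK1.2, hK2.2, hK3.2, hK4.2], by simp, by simp,
      by simp, by simp⟩
  have hscale : ∀ {L : NNReal} {f : ℝ → ℝ}, LipschitzWith L f → L ∈ Ioo 0 1 → L ≤ K →
      ∀ (n : ℕ) (E : Set ℝ),
        N ((K : ENNReal) ^ (n + 1)) (f '' E) ≤ (L : ENNReal) ^ (s : ℝ) * N ((K : ENNReal) ^ n) E := by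
    intro L f hf hL hLK n E
    refine le_trans ?_ (hf.mkMetric'_pre_image_le hL.1 hs _ E)
    refine OuterMeasure.mkMetric'.mono_pre _ ?_ _
    rw [pow_succ']
    gcongr
  have hbase : ∀ E : Set ℝ, E ⊆ Icc 0 1 → N 1 E ≤ 1 := by
    intro E hE
    have hdiam : Metric.ediam E ≤ 1 := by
      simpa using (Metric.ediam_mono hE).trans_eq (Real.ediam_Icc 0 1)
    exact (OuterMeasure.mkMetric'.pre_le hdiam).trans
      (ENNReal.rpow_le_one hdiam hs)
  have hbound : ∀ n : ℕ, N ((K : ENNReal) ^ n) A ≤ P ∧ N ((K : ENNReal) ^ n) B ≤ Q := by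
    intro n
    induction n with
    | zero =>
      rw [pow_zero]
      exact ⟨(hbase A hA01).trans hP1, (hbase B hB01).trans hQ1⟩
    | succ n ih =>
      have hAB : N ((K : ENNReal) ^ n) (A ∪ B) ≤ P + Q :=
        (measure_union_le A B).trans (add_le_add ih.1 ih.2)
      constructor
      · refine ((measure_mono hA).trans (measure_union_le _ _)).trans (le_trans ?_ hPsub)
        exact add_le_add ((hscale hf1 hK1 hle1 n _).trans (by gcongr))
          ((hscale hf2 hK2 hle2 n _).trans (by gcongr; exact ih.1))
      · refine ((measure_mono hB).trans (measure_union_le _ _)).trans (le_trans ?_ hQsub)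
        exact add_le_add ((hscale hf4 hK4 hle4 n _).trans (by gcongr))
          ((hscale hf3 hK3 hle3 n _).trans (by gcongr; exact ih.2))
  apply dimH_le_of_hausdorffMeasure_ne_top
  refine ne_top_of_le_ne_top (ENNReal.add_ne_top.2 ⟨hP, hQ⟩) ?_
  have hcoe : μH[(s : ℝ)] (A ∪ B) =
      OuterMeasure.mkMetric' (fun t : Set ℝ => Metric.ediam t ^ (s : ℝ)) (A ∪ B) :=
    (congrFun (OuterMeasure.coe_mkMetric fun r : ENNReal => r ^ (s : ℝ)) (A ∪ B)).symm
  rw [hcoe]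
  refine le_of_tendsto (OuterMeasure.mkMetric'.tendsto_pre _ _) ?_
  filter_upwards [self_mem_nhdsWithin] with r hr
  obtain ⟨n, hn⟩ := ((ENNReal.tendsto_pow_atTop_nhds_zero_of_lt_one
    (ENNReal.coe_lt_one_iff.2 hK)).eventually (gt_mem_nhds hr)).exists
  exact (OuterMeasure.mkMetric'.mono_pre _ hn.le _).trans
    ((measure_union_le A B).trans (add_le_add (hbound n).1 (hbound n).2))

/-- The invariance of `Λ` under the fixed-point-breaking system, split at the breaking point
into the four affine branches. -/
structure IsBranchInvariant (φ2 ρ1 ρ2 ρ3 ρ4 : ℝ) (Λ : Set ℝ) : Prop where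
  subset_Icc : Λ ⊆ Icc 0 1
  break_mem : φ2 ∈ Λ
  branch_one : ∀ x ∈ Λ, ρ1 * x ∈ Λ
  branch_two : ∀ x ∈ Λ, x ≤ φ2 → ρ2 * x + φ2 * (1 - ρ2) ∈ Λ
  branch_three : ∀ x ∈ Λ, φ2 ≤ x → ρ3 * x + φ2 * (1 - ρ3) ∈ Λ
  branch_four : ∀ x ∈ Λ, ρ4 * x + (1 - ρ4) ∈ Λ
  cases_branch : ∀ x ∈ Λ, (∃ y ∈ Λ, x = ρ1 * y) ∨
    (∃ y ∈ Λ, y ≤ φ2 ∧ x = ρ2 * y + φ2 * (1 - ρ2)) ∨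
    (∃ y ∈ Λ, φ2 ≤ y ∧ x = ρ3 * y + φ2 * (1 - ρ3)) ∨ (∃ y ∈ Λ, x = ρ4 * y + (1 - ρ4))

theorem mapTwo_of_le {φ2 ρ2 ρ3 x : ℝ} (hx : x ≤ φ2) :
    mapTwo φ2 ρ2 ρ3 x = ρ2 * x + φ2 * (1 - ρ2) := if_pos hx

theorem mapTwo_of_ge {φ2 ρ2 ρ3 x : ℝ} (hx : φ2 ≤ x) :
    mapTwo φ2 ρ2 ρ3 x = ρ3 * x + φ2 * (1 - ρ3) := by
  rcases hx.eq_or_lt with rfl | hx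
  · rw [mapTwo_of_le le_rfl]; ring
  · exact if_neg hx.not_ge

theorem tendsto_iterate_mapTwo {φ2 ρ2 ρ3 : ℝ} (h2 : ρ2 ∈ Ioo (0:ℝ) 1) (h3 : ρ3 ∈ Ioo (0:ℝ) 1)
    (x : ℝ) : Filter.Tendsto (fun n => (mapTwo φ2 ρ2 ρ3)^[n] x) Filter.atTop (nhds φ2) := by
  rcases le_total x φ2 with hx | hx
  · have hiter : ∀ n, (mapTwo φ2 ρ2 ρ3)^[n] x = φ2 - ρ2 ^ n * (φ2 - x) := by
      intro n
      induction n with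
      | zero => simp
      | succ n ih =>
        have hnn : 0 ≤ ρ2 ^ n * (φ2 - x) := mul_nonneg (pow_nonneg h2.1.le n) (sub_nonneg.2 hx)
        rw [Function.iterate_succ_apply', ih, mapTwo_of_le (by linarith)]
        ring
    simp_rw [hiter]
    simpa using tendsto_const_nhds.sub
      ((tendsto_pow_atTop_nhds_zero_of_lt_one h2.1.le h2.2).mul_const (φ2 - x))
  · have hiter : ∀ n, (mapTwo φ2 ρ2 ρ3)^[n] x = φ2 + ρ3 ^ n * (x - φ2) := by
      intro n
      induction n with
      | zero => simp
      | succ n ih =>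
        have hnn : 0 ≤ ρ3 ^ n * (x - φ2) := mul_nonneg (pow_nonneg h3.1.le n) (sub_nonneg.2 hx)
        rw [Function.iterate_succ_apply', ih, mapTwo_of_ge (by linarith)]
        ring
    simp_rw [hiter]
    simpa using tendsto_const_nhds.add
      ((tendsto_pow_atTop_nhds_zero_of_lt_one h3.1.le h3.2).mul_const (x - φ2))

theorem IsBranchInvariant.of_isCompact {φ2 ρ1 ρ2 ρ3 ρ4 : ℝ} {Λ : Set ℝ}
    (hφ : φ2 ∈ Ioo (0:ℝ) 1)
    (h1 : ρ1 ∈ Ioo (0:ℝ) 1) (h2 : ρ2 ∈ Ioo (0:ℝ) 1)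
    (h3 : ρ3 ∈ Ioo (0:ℝ) 1) (h4 : ρ4 ∈ Ioo (0:ℝ) 1)
    (hΛne : Λ.Nonempty) (hΛc : IsCompact Λ)
    (hatt : Λ = mapOne ρ1 '' Λ ∪ mapTwo φ2 ρ2 ρ3 '' Λ ∪ mapThree ρ4 '' Λ) :
    IsBranchInvariant φ2 ρ1 ρ2 ρ3 ρ4 Λ := by
  have m1 : ∀ x ∈ Λ, mapOne ρ1 x ∈ Λ := fun x hx => by
    rw [hatt]; exact Or.inl (Or.inl ⟨x, hx, rfl⟩)
  have m2 : ∀ x ∈ Λ, mapTwo φ2 ρ2 ρ3 x ∈ Λ := fun x hx => by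
    rw [hatt]; exact Or.inl (Or.inr ⟨x, hx, rfl⟩)
  have m3 : ∀ x ∈ Λ, mapThree ρ4 x ∈ Λ := fun x hx => by
    rw [hatt]; exact Or.inr ⟨x, hx, rfl⟩
  have hcases : ∀ x ∈ Λ, (∃ y ∈ Λ, x = ρ1 * y) ∨
      (∃ y ∈ Λ, y ≤ φ2 ∧ x = ρ2 * y + φ2 * (1 - ρ2)) ∨
      (∃ y ∈ Λ, φ2 ≤ y ∧ x = ρ3 * y + φ2 * (1 - ρ3)) ∨
      (∃ y ∈ Λ, x = ρ4 * y + (1 - ρ4)) := by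
    intro x hx
    rw [hatt] at hx
    rcases hx with (⟨y, hy, rfl⟩ | ⟨y, hy, rfl⟩) | ⟨y, hy, rfl⟩
    · exact Or.inl ⟨y, hy, rfl⟩
    · rcases le_total y φ2 with hyφ | hyφ
      · exact Or.inr (Or.inl ⟨y, hy, hyφ, mapTwo_of_le hyφ⟩)
      · exact Or.inr (Or.inr (Or.inl ⟨y, hy, hyφ, mapTwo_of_ge hyφ⟩))
    · exact Or.inr (Or.inr (Or.inr ⟨y, hy, rfl⟩))
  refine ⟨fun x hx => ⟨?_, ?_⟩, ?_, m1, fun x hx hxφ => ?_, fun x hx hxφ => ?_, m3, hcases⟩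
  · obtain ⟨w, hw, hmin⟩ := hΛc.exists_isLeast hΛne
    refine le_trans ?_ (hmin hx)
    by_contra! hneg
    rcases hcases w hw with ⟨y, hy, e⟩ | ⟨y, hy, -, e⟩ | ⟨y, hy, -, e⟩ | ⟨y, hy, e⟩ <;>
      have hwy := hmin hy
    · nlinarith [mul_le_mul_of_nonneg_left hwy h1.1.le, mul_pos (sub_pos.2 h1.2) (neg_pos.2 hneg)]
    · nlinarith [mul_le_mul_of_nonneg_left hwy h2.1.le, mul_pos (sub_pos.2 h2.2) (neg_pos.2 hneg),
        mul_pos (sub_pos.2 h2.2) hφ.1]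
    · nlinarith [mul_le_mul_of_nonneg_left hwy h3.1.le, mul_pos (sub_pos.2 h3.2) (neg_pos.2 hneg),
        mul_pos (sub_pos.2 h3.2) hφ.1]
    · nlinarith [mul_le_mul_of_nonneg_left hwy h4.1.le, mul_pos (sub_pos.2 h4.2) (neg_pos.2 hneg),
        h4.2]
  · obtain ⟨w, hw, hmax⟩ := hΛc.exists_isGreatest hΛne
    refine (hmax hx).trans ?_
    by_contra! hgt
    have hgt' := sub_pos.2 hgt
    rcases hcases w hw with ⟨y, hy, e⟩ | ⟨y, hy, -, e⟩ | ⟨y, hy, -, e⟩ | ⟨y, hy, e⟩ <;>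
      have hyw := hmax hy
    · nlinarith [mul_le_mul_of_nonneg_left hyw h1.1.le, mul_pos (sub_pos.2 h1.2) hgt', h1.2]
    · nlinarith [mul_le_mul_of_nonneg_left hyw h2.1.le, mul_pos (sub_pos.2 h2.2) hgt',
        mul_pos (sub_pos.2 h2.2) (sub_pos.2 hφ.2)]
    · nlinarith [mul_le_mul_of_nonneg_left hyw h3.1.le, mul_pos (sub_pos.2 h3.2) hgt',
        mul_pos (sub_pos.2 h3.2) (sub_pos.2 hφ.2)]
    · nlinarith [mul_le_mul_of_nonneg_left hyw h4.1.le, mul_pos (sub_pos.2 h4.2) hgt']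
  · obtain ⟨x, hx⟩ := hΛne
    refine hΛc.isClosed.mem_of_tendsto (tendsto_iterate_mapTwo h2 h3 x)
      (Filter.Eventually.of_forall fun n => ?_)
    induction n with
    | zero => exact hx
    | succ n ih => rw [Function.iterate_succ_apply']; exact m2 _ ih
  · rw [← mapTwo_of_le (ρ3 := ρ3) hxφ]; exact m2 x hx
  · rw [← mapTwo_of_ge (ρ2 := ρ2) hxφ]; exact m2 x hx

theorem lipschitzWith_affine {ρ : ℝ} (hρ : 0 ≤ ρ) (t : ℝ) :
    LipschitzWith ρ.toNNReal (fun x => ρ * x + t) :=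
  LipschitzWith.of_dist_le_mul fun x y => by
    rw [Real.dist_eq, Real.dist_eq, Real.coe_toNNReal ρ hρ, ← abs_of_nonneg hρ, ← abs_mul,
      abs_of_nonneg hρ]
    exact le_of_eq (by ring_nf)

theorem IsBranchInvariant.dimH_le {φ2 ρ1 ρ2 ρ3 ρ4 s : ℝ} {Λ : Set ℝ}
    (hΛ : IsBranchInvariant φ2 ρ1 ρ2 ρ3 ρ4 Λ)
    (h1 : ρ1 ∈ Ioo (0:ℝ) 1) (h2 : ρ2 ∈ Ioo (0:ℝ) 1)
    (h3 : ρ3 ∈ Ioo (0:ℝ) 1) (h4 : ρ4 ∈ Ioo (0:ℝ) 1)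
    (hd1 : ρ1 ≤ φ2) (hd2 : φ2 ≤ 1 - ρ4) (hs : 0 < s)
    (hsum : ρ1 ^ s / (1 - ρ2 ^ s) + ρ4 ^ s / (1 - ρ3 ^ s) = 1) :
    dimH Λ ≤ ENNReal.ofReal s := by
  have ha := (rpow_mem_Ioo h1 hs).1
  have hb := rpow_mem_Ioo h2 hs
  have hc := rpow_mem_Ioo h3 hs
  have hd := (rpow_mem_Ioo h4 hs).1
  have hb' := sub_pos.2 hb.2
  have hc' := sub_pos.2 hc.2
  set p := ρ1 ^ s / (1 - ρ2 ^ s) with hp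
  set q := ρ4 ^ s / (1 - ρ3 ^ s) with hq
  have hp0 : 0 < p := div_pos ha hb'
  have hq0 : 0 < q := div_pos hd hc'
  have hpeq : p * (1 - ρ2 ^ s) = ρ1 ^ s := div_mul_cancel₀ _ hb'.ne'
  have hqeq : q * (1 - ρ3 ^ s) = ρ4 ^ s := div_mul_cancel₀ _ hc'.ne'
  have hmem : ∀ {ρ : ℝ}, ρ ∈ Ioo (0:ℝ) 1 → ρ.toNNReal ∈ Ioo (0 : NNReal) 1 := fun h =>
    ⟨Real.toNNReal_pos.2 h.1, Real.toNNReal_lt_one.2 h.2⟩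
  have hpow : ∀ {ρ : ℝ}, ρ ∈ Ioo (0:ℝ) 1 →
      ((ρ.toNNReal : NNReal) : ENNReal) ^ ((s.toNNReal : NNReal) : ℝ) =
        ENNReal.ofReal (ρ ^ s) := fun h => by
    rw [Real.coe_toNNReal s hs.le]
    exact ENNReal.ofReal_rpow_of_pos h.1
  have hsplit : Λ = Λ ∩ Iic φ2 ∪ Λ ∩ Ici φ2 := by
    rw [← inter_union_distrib_left, Iic_union_Ici, inter_univ]
  have hA : Λ ∩ Iic φ2 ⊆ (fun x => ρ1 * x + 0) '' Λ ∪
      (fun x => ρ2 * x + φ2 * (1 - ρ2)) '' (Λ ∩ Iic φ2) := by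
    rintro x ⟨hx, hxφ : x ≤ φ2⟩
    rcases hΛ.cases_branch x hx with ⟨y, hy, rfl⟩ | ⟨y, hy, hyφ, rfl⟩ | ⟨y, hy, hyφ, rfl⟩ |
      ⟨y, hy, rfl⟩
    · exact Or.inl ⟨y, hy, add_zero _⟩
    · exact Or.inr ⟨y, ⟨hy, hyφ⟩, rfl⟩
    · have hyeq : y = φ2 := le_antisymm (by nlinarith [h3.1]) hyφ
      subst hyeq
      exact Or.inr ⟨y, ⟨hy, self_mem_Iic⟩, by ring⟩
    · have hy0 := (hΛ.subset_Icc hy).1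
      have hprod : ρ4 * y = 0 :=
        le_antisymm (by linarith) (mul_nonneg h4.1.le hy0)
      have hx : ρ4 * y + (1 - ρ4) = φ2 := by linarith
      exact Or.inr ⟨φ2, ⟨hΛ.break_mem, self_mem_Iic⟩, by rw [hx]; ring⟩
  have hB : Λ ∩ Ici φ2 ⊆ (fun x => ρ4 * x + (1 - ρ4)) '' Λ ∪
      (fun x => ρ3 * x + φ2 * (1 - ρ3)) '' (Λ ∩ Ici φ2) := by
    rintro x ⟨hx, hxφ : φ2 ≤ x⟩
    rcases hΛ.cases_branch x hx with ⟨y, hy, rfl⟩ | ⟨y, hy, hyφ, rfl⟩ | ⟨y, hy, hyφ, rfl⟩ |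
      ⟨y, hy, rfl⟩
    · have hy1 := (hΛ.subset_Icc hy).2
      have hx : ρ1 * y = φ2 := by nlinarith [h1.1]
      exact Or.inr ⟨φ2, ⟨hΛ.break_mem, self_mem_Ici⟩, by rw [hx]; ring⟩
    · have hyeq : y = φ2 := le_antisymm hyφ (by nlinarith [h2.1])
      subst hyeq
      exact Or.inr ⟨y, ⟨hy, self_mem_Ici⟩, by ring⟩
    · exact Or.inr ⟨y, ⟨hy, hyφ⟩, rfl⟩
    · exact Or.inl ⟨y, hy, rfl⟩
  set C := p⁻¹ + q⁻¹ with hC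
  have hCp : 1 ≤ C * p := by
    rw [hC, add_mul, inv_mul_cancel₀ hp0.ne']
    exact le_add_of_nonneg_right (by positivity)
  have hCq : 1 ≤ C * q := by
    rw [hC, add_mul, inv_mul_cancel₀ hq0.ne']
    exact le_add_of_nonneg_left (by positivity)
  have hC0 : 0 < C := by positivity
  rw [hsplit]
  refine dimH_union_le_of_graphDirected (s := s.toNNReal)
    (P := ENNReal.ofReal (C * p)) (Q := ENNReal.ofReal (C * q))
    (inter_subset_left.trans hΛ.subset_Icc) (inter_subset_left.trans hΛ.subset_Icc)
    (lipschitzWith_affine h1.1.le 0) (lipschitzWith_affine h2.1.le (φ2 * (1 - ρ2)))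
    (lipschitzWith_affine h3.1.le (φ2 * (1 - ρ3))) (lipschitzWith_affine h4.1.le (1 - ρ4))
    (hmem h1) (hmem h2) (hmem h3) (hmem h4) (by rwa [← hsplit])
    (by rwa [← hsplit]) (ENNReal.one_le_ofReal.2 hCp) (ENNReal.one_le_ofReal.2 hCq)
    ENNReal.ofReal_ne_top ENNReal.ofReal_ne_top ?_ ?_
  · rw [hpow h1, hpow h2, ← ENNReal.ofReal_add (by positivity) (by positivity),
      ← ENNReal.ofReal_mul ha.le, ← ENNReal.ofReal_mul hb.1.le,
      ← ENNReal.ofReal_add (by positivity) (mul_nonneg hb.1.le (by positivity)),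
      ← mul_add, hsum]
    exact ENNReal.ofReal_le_ofReal (le_of_eq (by rw [← hpeq]; ring))
  · rw [hpow h4, hpow h3, ← ENNReal.ofReal_add (by positivity) (by positivity),
      ← ENNReal.ofReal_mul hd.le, ← ENNReal.ofReal_mul hc.1.le,
      ← ENNReal.ofReal_add (by positivity) (mul_nonneg hc.1.le (by positivity)),
      ← mul_add, hsum]
    exact ENNReal.ofReal_le_ofReal (le_of_eq (by rw [← hqeq]; ring))

/-- A self-similar quantity `G` that is bounded by `C * D ^ s` wherever it cannot be rescaled
satisfies this bound everywhere. -/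
theorem le_mul_rpow_of_selfSimilar {α : Type*} {S : Set α} {D G : α → ℝ} {C K s : ℝ}
    (hs : 0 < s) (hK0 : 0 < K) (hK1 : K < 1)
    (hD0 : ∀ z ∈ S, 0 ≤ D z) (hD1 : ∀ z ∈ S, D z ≤ 1) (hG : ∀ z ∈ S, D z = 0 → G z ≤ 0)
    (hstep : ∀ z ∈ S, G z ≤ C * D z ^ s ∨
      ∃ w ∈ S, ∃ ρ, 0 < ρ ∧ ρ ≤ K ∧ D z = ρ * D w ∧ G z ≤ ρ ^ s * G w) :
    ∀ z ∈ S, G z ≤ C * D z ^ s := by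
  have hscale : ∀ n : ℕ, ∀ z ∈ S, K ^ n < D z → G z ≤ C * D z ^ s := by
    intro n
    induction n with
    | zero =>
      intro z hz hlt
      rw [pow_zero] at hlt
      exact absurd (hD1 z hz) hlt.not_ge
    | succ n ih =>
      intro z hz hlt
      rcases hstep z hz with h | ⟨w, hw, ρ, hρ0, hρK, hDw, hGw⟩
      · exact h
      · have hlt' : K ^ n < D w := by
          by_contra! hle
          rw [hDw, pow_succ'] at hlt
          exact hlt.not_ge (mul_le_mul hρK hle (hD0 w hw) hK0.le)
        calc G z ≤ ρ ^ s * G w := hGw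
          _ ≤ ρ ^ s * (C * D w ^ s) := by gcongr; exact ih w hw hlt'
          _ = C * D z ^ s := by rw [hDw, Real.mul_rpow hρ0.le (hD0 w hw)]; ring
  intro z hz
  rcases (hD0 z hz).eq_or_lt with h | h
  · rw [← h, Real.zero_rpow hs.ne', mul_zero]
    exact hG z hz h.symm
  · obtain ⟨n, hn⟩ := exists_pow_lt_of_lt_one h hK1
    exact hscale n z hz hn

/-- Existence of the devil staircase associated with the system: a `[0, 1]`-valued solution of
the functional equation of the distribution function of the natural measure. -/
theorem exists_staircase (φ2 ρ1 ρ2 ρ3 ρ4 : ℝ) {a b c d : ℝ} (ha : 0 ≤ a) (hb : 0 ≤ b)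
    (hc : 0 ≤ c) (hd : 0 ≤ d) (hab : a + b ≤ 1) (hcd : c + d ≤ 1) :
    ∃ F : ℝ → ℝ, (∀ x, F x ∈ Icc (0:ℝ) 1) ∧ ∀ x, F x =
      if x ≤ ρ1 then a * F (x / ρ1)
      else if x ≤ φ2 then a + b * F ((x - φ2 * (1 - ρ2)) / ρ2)
      else if x < 1 - ρ4 then 1 - c - d + c * F ((x - φ2 * (1 - ρ3)) / ρ3)
      else 1 - d + d * F ((x - (1 - ρ4)) / ρ4) := by
  let T : (ℝ → Icc (0:ℝ) 1) → ℝ → ℝ := fun u x =>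
    if x ≤ ρ1 then a * u (x / ρ1)
    else if x ≤ φ2 then a + b * u ((x - φ2 * (1 - ρ2)) / ρ2)
    else if x < 1 - ρ4 then 1 - c - d + c * u ((x - φ2 * (1 - ρ3)) / ρ3)
    else 1 - d + d * u ((x - (1 - ρ4)) / ρ4)
  have hT : ∀ u x, T u x ∈ Icc (0:ℝ) 1 := by
    intro u x
    have hu0 : ∀ y, 0 ≤ (u y : ℝ) := fun y => (u y).2.1
    have hu1 : ∀ y, (u y : ℝ) ≤ 1 := fun y => (u y).2.2
    have bounds : ∀ {k : ℝ}, 0 ≤ k → ∀ y, 0 ≤ k * (u y : ℝ) ∧ k * (u y : ℝ) ≤ k := fun hk y =>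
      ⟨mul_nonneg hk (hu0 y), mul_le_of_le_one_right hk (hu1 y)⟩
    simp only [T]
    split_ifs
    · have := bounds ha (x / ρ1)
      constructor <;> linarith
    · have := bounds hb ((x - φ2 * (1 - ρ2)) / ρ2)
      constructor <;> linarith
    · have := bounds hc ((x - φ2 * (1 - ρ3)) / ρ3)
      constructor <;> linarith
    · have := bounds hd ((x - (1 - ρ4)) / ρ4)
      constructor <;> linarith
  have hmono : Monotone fun (u : ℝ → Icc (0:ℝ) 1) x => (⟨T u x, hT u x⟩ : Icc (0:ℝ) 1) := by
    intro u v huv x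
    have huv' : ∀ y, (u y : ℝ) ≤ v y := fun y => huv y
    change T u x ≤ T v x
    simp only [T]
    split_ifs <;> gcongr <;> exact huv' _
  let Tmono : (ℝ → Icc (0:ℝ) 1) →o (ℝ → Icc (0:ℝ) 1) := ⟨_, hmono⟩
  refine ⟨fun x => (OrderHom.lfp Tmono x : ℝ), fun x => (OrderHom.lfp Tmono x).2, fun x => ?_⟩
  exact (congrArg Subtype.val (congrFun (OrderHom.map_lfp Tmono) x)).symm

/-- The branch relations satisfied by the devil staircase on the attractor, where `p` is the
value at the breaking point. -/
structure IsStaircase (φ2 ρ1 ρ2 ρ3 ρ4 a b c d p : ℝ) (Λ : Set ℝ) (F : ℝ → ℝ) : Prop where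
  mem_Icc : ∀ x, F x ∈ Icc (0:ℝ) 1
  apply_break : F φ2 = p
  apply_one : ∀ x ∈ Λ, F (ρ1 * x) = a * F x
  apply_two : ∀ x ∈ Λ, x ≤ φ2 → F (ρ2 * x + φ2 * (1 - ρ2)) = a + b * F x
  apply_three : ∀ x ∈ Λ, φ2 ≤ x → F (ρ3 * x + φ2 * (1 - ρ3)) = 1 - c - d + c * F x
  apply_four : ∀ x ∈ Λ, F (ρ4 * x + (1 - ρ4)) = 1 - d + d * F x

theorem exists_isStaircase {φ2 ρ1 ρ2 ρ3 ρ4 a b c d p : ℝ} {Λ : Set ℝ}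
    (hΛ : Λ ⊆ Icc 0 1) (h1 : 0 < ρ1) (h2 : 0 < ρ2) (h3 : 0 < ρ3) (h4 : 0 < ρ4)
    (hφ : φ2 ∈ Ioo (0:ℝ) 1) (hd1 : ρ1 < φ2 * (1 - ρ2)) (hd2 : φ2 + ρ3 * (1 - φ2) < 1 - ρ4)
    (ha : 0 ≤ a) (hb : b ∈ Ioo (0:ℝ) 1) (hc : c ∈ Ioo (0:ℝ) 1) (hd : 0 ≤ d)
    (hp : p * (1 - b) = a) (hq : (1 - p) * (1 - c) = d) (hp0 : 0 ≤ p) (hp1 : p ≤ 1) :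
    ∃ F, IsStaircase φ2 ρ1 ρ2 ρ3 ρ4 a b c d p Λ F := by
  obtain ⟨F, hF01, hF⟩ := exists_staircase φ2 ρ1 ρ2 ρ3 ρ4 ha hb.1.le hc.1.le hd
    (by nlinarith [hb.2]) (by nlinarith [hc.2])
  have h1φ : ρ1 < φ2 := by linarith [mul_pos hφ.1 h2]
  have hbreak : F φ2 = p := by
    have h := hF φ2
    rw [if_neg h1φ.not_ge, if_pos le_rfl, show (φ2 - φ2 * (1 - ρ2)) / ρ2 = φ2 by field_simp; ring]
      at h
    have hb' := (sub_pos.2 hb.2).ne'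
    apply mul_right_cancel₀ hb'
    linarith
  refine ⟨F, hF01, hbreak, fun x hx => ?_, fun x hx hxφ => ?_, fun x hx hxφ => ?_,
    fun x hx => ?_⟩
  · rw [hF, if_pos (mul_le_of_le_one_right h1.le (hΛ hx).2), mul_div_cancel_left₀ _ h1.ne']
  · have hx0 := (hΛ hx).1
    rw [hF, if_neg (by nlinarith), if_pos (by nlinarith), add_sub_cancel_right,
      mul_div_cancel_left₀ _ h2.ne']
  · rcases hxφ.eq_or_lt with rfl | hxφ
    · rw [show ρ3 * φ2 + φ2 * (1 - ρ3) = φ2 by ring, hbreak]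
      linarith
    · have hx1 := (hΛ hx).2
      have hgt : φ2 < ρ3 * x + φ2 * (1 - ρ3) := by nlinarith
      rw [hF, if_neg (h1φ.trans hgt).not_ge, if_neg hgt.not_ge, if_pos (by nlinarith),
        add_sub_cancel_right, mul_div_cancel_left₀ _ h3.ne']
  · have hx0 := mul_nonneg h4.le (hΛ hx).1
    have h3φ := mul_nonneg h3.le (sub_nonneg.2 hφ.2.le)
    rw [hF, if_neg (by linarith), if_neg (by linarith), if_neg (by linarith),
      add_sub_cancel_right, mul_div_cancel_left₀ _ h4.ne']

theorem IsStaircase.exists_abs_sub_le {φ2 ρ1 ρ2 ρ3 ρ4 a b c d p k : ℝ} {Λ : Set ℝ} {F : ℝ → ℝ}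
    (hF : IsStaircase φ2 ρ1 ρ2 ρ3 ρ4 a b c d p Λ F)
    (hΛ : IsBranchInvariant φ2 ρ1 ρ2 ρ3 ρ4 Λ)
    (h1 : 0 < ρ1) (h2 : 0 < ρ2) (h3 : 0 < ρ3) (h4 : 0 < ρ4)
    (hd1 : ρ1 ≤ φ2) (hd2 : φ2 ≤ 1 - ρ4)
    (ha : 0 < a) (hb : 0 < b) (hc : 0 < c) (hd : 0 < d)
    (hak : a ≤ k) (hbk : b ≤ k) (hck : c ≤ k) (hdk : d ≤ k)
    (hp : p * (1 - b) = a) (hq : (1 - p) * (1 - c) = d) (n : ℕ) :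
    (∀ y ∈ Icc 0 p, ∃ x ∈ Λ, x ≤ φ2 ∧ |F x - y| ≤ k ^ n) ∧
      (∀ y ∈ Icc p 1, ∃ x ∈ Λ, φ2 ≤ x ∧ |F x - y| ≤ k ^ n) := by
  have hp01 : p ∈ Icc (0:ℝ) 1 := hF.apply_break ▸ hF.mem_Icc φ2
  induction n with
  | zero =>
    constructor
    · rintro y ⟨hy0, hyp⟩
      refine ⟨φ2, hΛ.break_mem, le_rfl, ?_⟩
      rw [hF.apply_break, pow_zero, abs_le]
      constructor <;> linarith [hp01.1, hp01.2]
    · rintro y ⟨hyp, hy1⟩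
      refine ⟨φ2, hΛ.break_mem, le_rfl, ?_⟩
      rw [hF.apply_break, pow_zero, abs_le]
      constructor <;> linarith [hp01.1, hp01.2]
  | succ n ih =>
    have rescale : ∀ {m t x y : ℝ}, 0 < m → m ≤ k → |F x - (y - t) / m| ≤ k ^ n →
        |t + m * F x - y| ≤ k ^ (n + 1) := by
      intro m t x y hm hmk h
      have hEq : t + m * F x - y = m * (F x - (y - t) / m) := by
        field_simp
        ring
      rw [hEq, abs_mul, abs_of_pos hm, pow_succ']
      exact mul_le_mul hmk h (abs_nonneg _) (hm.le.trans hmk)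
    have ihall : ∀ y ∈ Icc (0:ℝ) 1, ∃ x ∈ Λ, |F x - y| ≤ k ^ n := by
      rintro y ⟨hy0, hy1⟩
      rcases le_total y p with hyp | hyp
      · obtain ⟨x, hx, -, h⟩ := ih.1 y ⟨hy0, hyp⟩
        exact ⟨x, hx, h⟩
      · obtain ⟨x, hx, -, h⟩ := ih.2 y ⟨hyp, hy1⟩
        exact ⟨x, hx, h⟩
    constructor
    · rintro y ⟨hy0, hyp⟩
      rcases le_total y a with hya | hya
      · obtain ⟨x, hx, h⟩ := ihall ((y - 0) / a)
          ⟨by rw [sub_zero]; positivity, by rw [sub_zero]; exact div_le_one_of_le₀ hya ha.le⟩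
        have hx1 := (hΛ.subset_Icc hx).2
        refine ⟨ρ1 * x, hΛ.branch_one x hx, by nlinarith, ?_⟩
        rw [hF.apply_one x hx, ← zero_add (a * F x)]
        exact rescale ha hak h
      · obtain ⟨x, hx, hxφ, h⟩ := ih.1 ((y - a) / b)
          ⟨div_nonneg (by linarith) hb.le, by rw [div_le_iff₀ hb]; linarith⟩
        refine ⟨_, hΛ.branch_two x hx hxφ, by nlinarith, ?_⟩
        rw [hF.apply_two x hx hxφ]
        exact rescale hb hbk h
    · rintro y ⟨hyp, hy1⟩
      rcases le_total y (1 - d) with hyd | hyd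
      · obtain ⟨x, hx, hxφ, h⟩ := ih.2 ((y - (1 - c - d)) / c)
          ⟨by rw [le_div_iff₀ hc]; linarith, by rw [div_le_iff₀ hc]; linarith⟩
        refine ⟨_, hΛ.branch_three x hx hxφ, by nlinarith, ?_⟩
        rw [hF.apply_three x hx hxφ]
        exact rescale hc hck h
      · obtain ⟨x, hx, h⟩ := ihall ((y - (1 - d)) / d)
          ⟨div_nonneg (by linarith) hd.le, by rw [div_le_iff₀ hd]; linarith⟩
        have hx0 := mul_nonneg h4.le (hΛ.subset_Icc hx).1
        refine ⟨_, hΛ.branch_four x hx, by linarith, ?_⟩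
        rw [hF.apply_four x hx]
        exact rescale hd hdk h

theorem one_le_inv_rpow_mul_rpow {η x s : ℝ} (hη : 0 < η) (hx : η ≤ x) (hs : 0 ≤ s) :
    1 ≤ (η ^ s)⁻¹ * x ^ s := by
  rw [inv_mul_eq_div, one_le_div (Real.rpow_pos_of_pos hη s)]
  exact Real.rpow_le_rpow hη.le hx hs

theorem IsStaircase.abs_apply_sub_le {φ2 ρ1 ρ2 ρ3 ρ4 p s η : ℝ} {Λ : Set ℝ} {F : ℝ → ℝ}
    (hF : IsStaircase φ2 ρ1 ρ2 ρ3 ρ4 (ρ1 ^ s) (ρ2 ^ s) (ρ3 ^ s) (ρ4 ^ s) p Λ F)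
    (hΛ : IsBranchInvariant φ2 ρ1 ρ2 ρ3 ρ4 Λ)
    (h1 : ρ1 ∈ Ioo (0:ℝ) 1) (h2 : ρ2 ∈ Ioo (0:ℝ) 1)
    (h3 : ρ3 ∈ Ioo (0:ℝ) 1) (h4 : ρ4 ∈ Ioo (0:ℝ) 1) (hφ : φ2 ∈ Ioo (0:ℝ) 1)
    (hη : 0 < η) (hη1 : ρ1 + η ≤ φ2 * (1 - ρ2)) (hη2 : φ2 + ρ3 * (1 - φ2) + η ≤ 1 - ρ4)
    (hs : 0 < s) (hp : p * (1 - ρ2 ^ s) = ρ1 ^ s) (hq : (1 - p) * (1 - ρ3 ^ s) = ρ4 ^ s) :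
    ∀ x ∈ Λ, ∀ y ∈ Λ, |F x - F y| ≤ 2 * (η ^ s)⁻¹ * |x - y| ^ s := by
  set H := (η ^ s)⁻¹ with hH
  have hH0 : 0 ≤ H := by positivity
  obtain ⟨K, hK1, hle1, hle2, hle3, hle4⟩ :
      ∃ K : ℝ, K < 1 ∧ ρ1 ≤ K ∧ ρ2 ≤ K ∧ ρ3 ≤ K ∧ ρ4 ≤ K :=
    ⟨max (max ρ1 ρ2) (max ρ3 ρ4), by simp [h1.2, h2.2, h3.2, h4.2], by simp, by simp,
      by simp, by simp⟩
  have hK0 : 0 < K := h1.1.trans_le hle1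
  have hosc : ∀ x y, |F x - F y| ≤ 1 := fun x y => by
    have hx := hF.mem_Icc x
    have hy := hF.mem_Icc y
    rw [abs_le]
    constructor <;> linarith [hx.1, hx.2, hy.1, hy.2]
  have hdist : ∀ x ∈ Λ, ∀ y ∈ Λ, |x - y| ≤ 1 := fun x hx y hy => by
    have hx := hΛ.subset_Icc hx
    have hy := hΛ.subset_Icc hy
    rw [abs_le]
    constructor <;> linarith [hx.1, hx.2, hy.1, hy.2]
  have hφ2 : 0 < φ2 * ρ2 := mul_pos hφ.1 h2.1
  have hφ3 : 0 ≤ ρ3 * (1 - φ2) := mul_nonneg h3.1.le (sub_nonneg.2 hφ.2.le)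
  have range_one : ∀ x ∈ Λ, ρ1 * x ≤ ρ1 := fun x hx =>
    mul_le_of_le_one_right h1.1.le (hΛ.subset_Icc hx).2
  have range_two : ∀ x ∈ Λ, φ2 * (1 - ρ2) ≤ ρ2 * x + φ2 * (1 - ρ2) := fun x hx =>
    le_add_of_nonneg_left (mul_nonneg h2.1.le (hΛ.subset_Icc hx).1)
  have range_three : ∀ x ∈ Λ, ρ3 * x + φ2 * (1 - ρ3) ≤ φ2 + ρ3 * (1 - φ2) := fun x hx => by
    linarith [mul_le_of_le_one_right h3.1.le (hΛ.subset_Icc hx).2]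
  have range_four : ∀ x ∈ Λ, 1 - ρ4 ≤ ρ4 * x + (1 - ρ4) := fun x hx =>
    le_add_of_nonneg_left (mul_nonneg h4.1.le (hΛ.subset_Icc hx).1)
  have hfar : ∀ x y, η ≤ |x - y| → |F x - F y| ≤ H * |x - y| ^ s := fun x y h =>
    (hosc x y).trans (one_le_inv_rpow_mul_rpow hη h hs.le)
  have hscale : ∀ {ρ x y X Y : ℝ}, 0 < ρ → X - Y = ρ * (x - y) →
      F X - F Y = ρ ^ s * (F x - F y) →
      |X - Y| = ρ * |x - y| ∧ |F X - F Y| ≤ ρ ^ s * |F x - F y| := by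
    intro ρ x y X Y hρ hXY hFXY
    rw [hXY, hFXY, abs_mul, abs_mul, abs_of_pos hρ, abs_of_pos (Real.rpow_pos_of_pos hρ s)]
    exact ⟨rfl, le_rfl⟩
  -- Distances to the breaking point are rescaled by the two branches of the middle map.
  have hbreak : ∀ x ∈ Λ, |F x - F φ2| ≤ H * |x - φ2| ^ s := by
    refine le_mul_rpow_of_selfSimilar (D := fun x => |x - φ2|) (G := fun x => |F x - F φ2|)
      hs hK0 hK1 (fun x _ => abs_nonneg _) (fun x hx => hdist x hx φ2 hΛ.break_mem)
      (fun x _ h => ?_) (fun x hx => ?_)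
    · rw [sub_eq_zero.1 (abs_eq_zero.1 h), sub_self, abs_zero]
    · rcases hΛ.cases_branch x hx with ⟨y, hy, rfl⟩ | ⟨y, hy, hyφ, rfl⟩ | ⟨y, hy, hyφ, rfl⟩ |
        ⟨y, hy, rfl⟩
      · refine Or.inl (hfar _ _ (le_abs.2 (Or.inr ?_)))
        linarith [range_one y hy]
      · refine Or.inr ⟨y, hy, ρ2, h2.1, hle2, hscale h2.1 (by ring) ?_⟩
        rw [hF.apply_two y hy hyφ, hF.apply_break]
        linarith
      · refine Or.inr ⟨y, hy, ρ3, h3.1, hle3, hscale h3.1 (by ring) ?_⟩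
        rw [hF.apply_three y hy hyφ, hF.apply_break]
        linarith
      · refine Or.inl (hfar _ _ (le_abs.2 (Or.inl ?_)))
        linarith [range_four y hy]
  have hacross : ∀ x ∈ Λ, ∀ y ∈ Λ, x ≤ φ2 → φ2 ≤ y →
      |F x - F y| ≤ 2 * H * |x - y| ^ s := by
    intro x hx y hy hxφ hyφ
    have hxy : |x - φ2| ≤ |x - y| := by
      rw [abs_of_nonpos (by linarith), abs_of_nonpos (by linarith)]
      linarith
    have hyx : |y - φ2| ≤ |x - y| := by
      rw [abs_of_nonneg (by linarith), abs_of_nonpos (by linarith)]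
      linarith
    calc |F x - F y| ≤ |F x - F φ2| + |F y - F φ2| := by
          rw [abs_sub_comm (F y)]; exact abs_sub_le _ _ _
      _ ≤ H * |x - φ2| ^ s + H * |y - φ2| ^ s := add_le_add (hbreak x hx) (hbreak y hy)
      _ ≤ H * |x - y| ^ s + H * |x - y| ^ s := by gcongr
      _ = 2 * H * |x - y| ^ s := by ring
  have hfar2 : ∀ x y, η ≤ |x - y| → |F x - F y| ≤ 2 * H * |x - y| ^ s := fun x y h => by
    have hnn : 0 ≤ H * |x - y| ^ s := by positivity
    linarith [hfar x y h]
  have hacross' : ∀ x ∈ Λ, ∀ y ∈ Λ, φ2 ≤ x → y ≤ φ2 →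
      |F x - F y| ≤ 2 * H * |x - y| ^ s := by
    intro x hx y hy hxφ hyφ
    rw [abs_sub_comm (F x), abs_sub_comm x]
    exact hacross y hy x hx hyφ hxφ
  have le_one : ∀ x ∈ Λ, ρ1 * x ≤ φ2 := fun x hx => by linarith [range_one x hx]
  have le_two : ∀ x, x ≤ φ2 → ρ2 * x + φ2 * (1 - ρ2) ≤ φ2 := fun x hx => by
    linarith [mul_le_mul_of_nonneg_left hx h2.1.le]
  have ge_three : ∀ x, φ2 ≤ x → φ2 ≤ ρ3 * x + φ2 * (1 - ρ3) := fun x hx => by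
    linarith [mul_le_mul_of_nonneg_left hx h3.1.le]
  have ge_four : ∀ x ∈ Λ, φ2 ≤ ρ4 * x + (1 - ρ4) := fun x hx => by linarith [range_four x hx]
  have hpair : ∀ z ∈ Λ ×ˢ Λ, |F z.1 - F z.2| ≤ 2 * H * |z.1 - z.2| ^ s := by
    refine le_mul_rpow_of_selfSimilar (D := fun z : ℝ × ℝ => |z.1 - z.2|)
      (G := fun z : ℝ × ℝ => |F z.1 - F z.2|) hs hK0 hK1 (fun z _ => abs_nonneg _)
      (fun z hz => hdist _ hz.1 _ hz.2) (fun z _ h => ?_) ?_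
    · rw [sub_eq_zero.1 (abs_eq_zero.1 h), sub_self, abs_zero]
    · rintro ⟨X, Y⟩ ⟨hX : X ∈ Λ, hY : Y ∈ Λ⟩
      dsimp only
      rcases hΛ.cases_branch X hX with ⟨x, hx, rfl⟩ | ⟨x, hx, hxφ, rfl⟩ | ⟨x, hx, hxφ, rfl⟩ |
          ⟨x, hx, rfl⟩ <;>
        rcases hΛ.cases_branch Y hY with ⟨y, hy, rfl⟩ | ⟨y, hy, hyφ, rfl⟩ | ⟨y, hy, hyφ, rfl⟩ |
          ⟨y, hy, rfl⟩
      · refine Or.inr ⟨(x, y), ⟨hx, hy⟩, ρ1, h1.1, hle1, hscale h1.1 (by ring) ?_⟩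
        rw [hF.apply_one x hx, hF.apply_one y hy]
        ring
      · refine Or.inl (hfar2 _ _ (le_abs.2 (Or.inr ?_)))
        linarith [range_one x hx, range_two y hy]
      · exact Or.inl (hacross _ hX _ hY (le_one x hx) (ge_three y hyφ))
      · exact Or.inl (hacross _ hX _ hY (le_one x hx) (ge_four y hy))
      · refine Or.inl (hfar2 _ _ (le_abs.2 (Or.inl ?_)))
        linarith [range_one y hy, range_two x hx]
      · refine Or.inr ⟨(x, y), ⟨hx, hy⟩, ρ2, h2.1, hle2, hscale h2.1 (by ring) ?_⟩
        rw [hF.apply_two x hx hxφ, hF.apply_two y hy hyφ]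
        ring
      · exact Or.inl (hacross _ hX _ hY (le_two x hxφ) (ge_three y hyφ))
      · exact Or.inl (hacross _ hX _ hY (le_two x hxφ) (ge_four y hy))
      · exact Or.inl (hacross' _ hX _ hY (ge_three x hxφ) (le_one y hy))
      · exact Or.inl (hacross' _ hX _ hY (ge_three x hxφ) (le_two y hyφ))
      · refine Or.inr ⟨(x, y), ⟨hx, hy⟩, ρ3, h3.1, hle3, hscale h3.1 (by ring) ?_⟩
        rw [hF.apply_three x hx hxφ, hF.apply_three y hy hyφ]
        ring
      · refine Or.inl (hfar2 _ _ (le_abs.2 (Or.inr ?_)))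
        linarith [range_three x hx, range_four y hy]
      · exact Or.inl (hacross' _ hX _ hY (ge_four x hx) (le_one y hy))
      · exact Or.inl (hacross' _ hX _ hY (ge_four x hx) (le_two y hyφ))
      · refine Or.inl (hfar2 _ _ (le_abs.2 (Or.inl ?_)))
        linarith [range_three y hy, range_four x hx]
      · refine Or.inr ⟨(x, y), ⟨hx, hy⟩, ρ4, h4.1, hle4, hscale h4.1 (by ring) ?_⟩
        rw [hF.apply_four x hx, hF.apply_four y hy]
        ring
  exact fun x hx y hy => hpair (x, y) ⟨hx, hy⟩

theorem IsBranchInvariant.le_dimH {φ2 ρ1 ρ2 ρ3 ρ4 s : ℝ} {Λ : Set ℝ}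
    (hΛ : IsBranchInvariant φ2 ρ1 ρ2 ρ3 ρ4 Λ) (hΛc : IsCompact Λ) (hφ : φ2 ∈ Ioo (0:ℝ) 1)
    (h1 : ρ1 ∈ Ioo (0:ℝ) 1) (h2 : ρ2 ∈ Ioo (0:ℝ) 1)
    (h3 : ρ3 ∈ Ioo (0:ℝ) 1) (h4 : ρ4 ∈ Ioo (0:ℝ) 1)
    (hd1 : ρ1 < φ2 * (1 - ρ2)) (hd2 : φ2 + ρ3 * (1 - φ2) < 1 - ρ4) (hs : 0 < s)
    (hsum : ρ1 ^ s / (1 - ρ2 ^ s) + ρ4 ^ s / (1 - ρ3 ^ s) = 1) :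
    ENNReal.ofReal s ≤ dimH Λ := by
  have ha := rpow_mem_Ioo h1 hs
  have hb := rpow_mem_Ioo h2 hs
  have hc := rpow_mem_Ioo h3 hs
  have hd := rpow_mem_Ioo h4 hs
  have hb' := sub_pos.2 hb.2
  have hc' := sub_pos.2 hc.2
  set p := ρ1 ^ s / (1 - ρ2 ^ s) with hpdef
  have hp0 : 0 < p := div_pos ha.1 hb'
  have hq1 : 1 - p = ρ4 ^ s / (1 - ρ3 ^ s) := by linarith
  have hq0 : 0 < 1 - p := by
    rw [hq1]
    exact div_pos hd.1 hc'
  have hp : p * (1 - ρ2 ^ s) = ρ1 ^ s := div_mul_cancel₀ _ hb'.ne'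
  have hq : (1 - p) * (1 - ρ3 ^ s) = ρ4 ^ s := by
    rw [hq1]
    exact div_mul_cancel₀ _ hc'.ne'
  have hd1' : ρ1 ≤ φ2 := by linarith [mul_pos hφ.1 h2.1]
  have hd2' : φ2 ≤ 1 - ρ4 := by linarith [mul_pos h3.1 (sub_pos.2 hφ.2)]
  obtain ⟨F, hF⟩ := exists_isStaircase hΛ.subset_Icc h1.1 h2.1 h3.1 h4.1 hφ hd1 hd2 ha.1.le
    hb hc hd.1.le hp hq hp0.le (by linarith)
  obtain ⟨η, hη, hη1, hη2⟩ : ∃ η : ℝ, 0 < η ∧ ρ1 + η ≤ φ2 * (1 - ρ2) ∧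
      φ2 + ρ3 * (1 - φ2) + η ≤ 1 - ρ4 := by
    refine ⟨min (φ2 * (1 - ρ2) - ρ1) (1 - ρ4 - (φ2 + ρ3 * (1 - φ2))),
      lt_min (by linarith) (by linarith), ?_, ?_⟩
    · linarith [min_le_left (φ2 * (1 - ρ2) - ρ1) (1 - ρ4 - (φ2 + ρ3 * (1 - φ2)))]
    · linarith [min_le_right (φ2 * (1 - ρ2) - ρ1) (1 - ρ4 - (φ2 + ρ3 * (1 - φ2)))]
  have hbound := hF.abs_apply_sub_le hΛ h1 h2 h3 h4 hφ hη hη1 hη2 hs hp hq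
  have hC0 : 0 ≤ 2 * (η ^ s)⁻¹ := by positivity
  have hholder : HolderOnWith (2 * (η ^ s)⁻¹).toNNReal s.toNNReal F Λ := by
    intro x hx y hy
    rw [edist_dist, edist_dist, Real.coe_toNNReal s hs.le,
      ENNReal.ofReal_rpow_of_nonneg dist_nonneg hs.le]
    change _ ≤ ENNReal.ofReal _ * _
    rw [← ENNReal.ofReal_mul hC0]
    exact ENNReal.ofReal_le_ofReal (hbound x hx y hy)
  have hs' : 0 < s.toNNReal := Real.toNNReal_pos.2 hs
  have hclosed : IsClosed (F '' Λ) := (hΛc.image_of_continuousOn (hholder.continuousOn hs')).isClosed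
  obtain ⟨k, hk, hak, hbk, hck, hdk⟩ :
      ∃ k : ℝ, k < 1 ∧ ρ1 ^ s ≤ k ∧ ρ2 ^ s ≤ k ∧ ρ3 ^ s ≤ k ∧ ρ4 ^ s ≤ k :=
    ⟨max (max (ρ1 ^ s) (ρ2 ^ s)) (max (ρ3 ^ s) (ρ4 ^ s)), by simp [ha.2, hb.2, hc.2, hd.2],
      by simp, by simp, by simp, by simp⟩
  have hsurj : Icc (0:ℝ) 1 ⊆ F '' Λ := by
    intro y hy
    rw [← hclosed.closure_eq, Metric.mem_closure_iff]
    intro ε hε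
    obtain ⟨n, hn⟩ := exists_pow_lt_of_lt_one hε hk
    have happrox := hF.exists_abs_sub_le hΛ h1.1 h2.1 h3.1 h4.1 hd1' hd2' ha.1 hb.1 hc.1 hd.1
      hak hbk hck hdk hp hq n
    obtain ⟨x, hx, hxy⟩ : ∃ x ∈ Λ, |F x - y| ≤ k ^ n := by
      rcases le_total y p with hyp | hyp
      · obtain ⟨x, hx, -, h⟩ := happrox.1 y ⟨hy.1, hyp⟩
        exact ⟨x, hx, h⟩
      · obtain ⟨x, hx, -, h⟩ := happrox.2 y ⟨hyp, hy.2⟩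
        exact ⟨x, hx, h⟩
    refine ⟨F x, ⟨x, hx, rfl⟩, ?_⟩
    rw [dist_comm, Real.dist_eq]
    exact hxy.trans_lt hn
  have hone : (1 : ENNReal) ≤ dimH Λ / s.toNNReal := by
    calc (1 : ENNReal) = dimH (Icc (0:ℝ) 1) := by
          rw [Real.dimH_of_nonempty_interior (by simp), Module.finrank_self, Nat.cast_one]
      _ ≤ dimH (F '' Λ) := dimH_mono hsurj
      _ ≤ dimH Λ / s.toNNReal := hholder.dimH_image_le hs'
  rwa [ENNReal.le_div_iff_mul_le (Or.inl (by simpa using hs)) (Or.inl ENNReal.coe_ne_top),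
    one_mul] at hone

/-- There is a unique `s* ≥ 0` with spectral radius of `M(s*)` equal to `1`;
it satisfies `ρ₁^s + ρ₂^s + ρ₃^s + ρ₄^s - ρ₁^s ρ₃^s - ρ₂^s ρ₃^s - ρ₂^s ρ₄^s = 1` and equals
the Hausdorff dimension of the attractor. -/
theorem statement3 (φ2 ρ1 ρ2 ρ3 ρ4 : ℝ)
    (hφ : φ2 ∈ Ioo (0:ℝ) 1)
    (h1 : ρ1 ∈ Ioo (0:ℝ) 1) (h2 : ρ2 ∈ Ioo (0:ℝ) 1)
    (h3 : ρ3 ∈ Ioo (0:ℝ) 1) (h4 : ρ4 ∈ Ioo (0:ℝ) 1)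
    (hne : ρ2 ≠ ρ3)
    (hd1 : ρ1 < φ2 * (1 - ρ2)) (hd2 : φ2 + ρ3 * (1 - φ2) < 1 - ρ4)
    (Λ : Set ℝ) (hΛne : Λ.Nonempty) (hΛc : IsCompact Λ)
    (hatt : Λ = mapOne ρ1 '' Λ ∪ mapTwo φ2 ρ2 ρ3 '' Λ ∪ mapThree ρ4 '' Λ) :
    ∃ s : ℝ, (0 ≤ s ∧
        spectralRadius ℂ ((gdMatrix ρ1 ρ2 ρ3 ρ4 s).map (fun x : ℝ => (x : ℂ))) = 1) ∧
      (∀ s' : ℝ, 0 ≤ s' →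
        spectralRadius ℂ ((gdMatrix ρ1 ρ2 ρ3 ρ4 s').map (fun x : ℝ => (x : ℂ))) = 1 →
        s' = s) ∧
      ρ1 ^ s + ρ2 ^ s + ρ3 ^ s + ρ4 ^ s
        - ρ1 ^ s * ρ3 ^ s - ρ2 ^ s * ρ3 ^ s - ρ2 ^ s * ρ4 ^ s = 1 ∧
      dimH Λ = ENNReal.ofReal s := by
  obtain ⟨s, hs, hs1⟩ := exists_perronRoot_rpow_eq_one h1 h2 h3 h4
  have ha := (rpow_mem_Ioo h1 hs).1
  have hb := rpow_mem_Ioo h2 hs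
  have hc := rpow_mem_Ioo h3 hs
  have hd := (rpow_mem_Ioo h4 hs).1
  have hsum := (perronRoot_eq_one_iff_div ha hb hc hd).1 hs1
  have hinv := IsBranchInvariant.of_isCompact hφ h1 h2 h3 h4 hΛne hΛc hatt
  refine ⟨s, ⟨hs.le, (spectralRadius_gdMatrix_eq_one_iff s h1.1 h2.1 h3.1 h4.1).2 hs1⟩,
    fun t ht ht1 => ?_, ((perronRoot_eq_one_iff _ _ _ _ (by positivity)).1 hs1).2,
    le_antisymm ?_ ?_⟩
  · exact eq_of_perronRoot_rpow_eq_one h1 h2 h3 h4 hs ht hs1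
      ((spectralRadius_gdMatrix_eq_one_iff t h1.1 h2.1 h3.1 h4.1).1 ht1)
  · exact hinv.dimH_le h1 h2 h3 h4 (by linarith [mul_pos hφ.1 h2.1])
      (by linarith [mul_pos h3.1 (sub_pos.2 hφ.2)]) hs hsum
  · exact hinv.le_dimH hΛc hφ h1 h2 h3 h4 hd1 hd2 hs hsum
end
end
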